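/- Let Γ̃ ⊂ Ω be a simple union of C¹ curve segments with dist(Γ̃, ∂Ω) > 0, and let u : Ω → ℝ be a bounded measurable function that is C¹ on Ω \ Γ̃, whose gradient ∇u is bounded on Ω \ Γ̃ and extends continuously to cl(Ω) \ Γ̃. Then limsup_{n→∞} R_n(u) ≤ ∫_{Ω \ Γ̃} |∇u(x)| dx + α·ℋ¹(Γ̃), where |∇u| is the Euclidean norm of the gradient and ℋ¹ is the 1-dimensional Hausdorff measure. -/

import Mathlib

open MeasureTheory
open scoped ENNReal

noncomputable def IsSimpleCurveUnion (Γ : Set (EuclideanSpace ℝ (Fin 2))) : Prop :=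
  ∃ (K : ℕ) (γ : Fin K → ℝ → EuclideanSpace ℝ (Fin 2)) (b : Fin K → ℝ),
    (∀ i, 0 < b i) ∧
    (∀ i, ContDiff ℝ 1 (γ i)) ∧
    (∀ i t, ‖deriv (γ i) t‖ = 1) ∧
    (∀ i, Set.InjOn (γ i) (Set.Icc 0 (b i))) ∧
    (∀ i j, i ≠ j →
      Disjoint (γ i '' Set.Icc 0 (b i)) (γ j '' Set.Icc 0 (b j))) ∧
    Γ = ⋃ i, γ i '' Set.Icc 0 (b i)

/-- The point of `ℝ²` with integer coordinates `k`. -/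
noncomputable def ivec (k : Fin 2 → ℤ) : EuclideanSpace ℝ (Fin 2) := WithLp.toLp 2 (fun i => (k i : ℝ))

/-- Partial derivative `∂_j g` of a scalar function. -/
noncomputable def pd (j : Fin 2) (g : EuclideanSpace ℝ (Fin 2) → ℝ)
    (x : EuclideanSpace ℝ (Fin 2)) : ℝ :=
  fderiv ℝ g x (EuclideanSpace.single j 1)

/-- The wavelet coefficient in its primary (derivative-free) form:
`c_{n,j}[u;k] = −(∫φ_j)⁻¹ 2^{n−1} ∫_Ω u(x) · 2^{2(n−1)} (∂_jφ_j)(2^{n−1}(x − 2^{−n}k)) dx`. -/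
noncomputable def cnj (Ω : Set (EuclideanSpace ℝ (Fin 2)))
    (φ : Fin 2 → EuclideanSpace ℝ (Fin 2) → ℝ) (u : EuclideanSpace ℝ (Fin 2) → ℝ)
    (n : ℕ) (j : Fin 2) (k : Fin 2 → ℤ) : ℝ :=
  -((∫ y, φ j y)⁻¹) * (2 : ℝ) ^ ((n : ℤ) - 1) * ∫ x in Ω, u x *
    ((2 : ℝ) ^ (2 * ((n : ℤ) - 1)) *
      pd j (φ j) ((2 : ℝ) ^ ((n : ℤ) - 1) • (x - (2 : ℝ) ^ (-(n : ℤ)) • ivec k)))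

/-- `c_n[u;k] = (c_{n,1}[u;k]² + c_{n,2}[u;k]²)^{1/2}`. -/
noncomputable def cn (Ω : Set (EuclideanSpace ℝ (Fin 2)))
    (φ : Fin 2 → EuclideanSpace ℝ (Fin 2) → ℝ) (u : EuclideanSpace ℝ (Fin 2) → ℝ)
    (n : ℕ) (k : Fin 2 → ℤ) : ℝ :=
  Real.sqrt (cnj Ω φ u n 0 k ^ 2 + cnj Ω φ u n 1 k ^ 2)

/-- The admissible lattice `𝕂_n`. -/
def Kn (Ω : Set (EuclideanSpace ℝ (Fin 2))) (Cw : ℝ) (n : ℕ) : Set (Fin 2 → ℤ) :=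
  {k | Metric.closedBall ((2 : ℝ) ^ (-(n : ℤ)) • ivec k) ((2 : ℝ) ^ (-((n : ℤ) - 1)) * Cw) ⊆ Ω}

/-- The two-scale radius `H_n = 2^{−n/2}`. -/
noncomputable def Hrad (n : ℕ) : ℝ := (2 : ℝ) ^ (-(n : ℝ) / 2)

/-- The truncation threshold `M_n = α/(2 H_n)`. -/
noncomputable def Mthr (α : ℝ) (n : ℕ) : ℝ := α / (2 * Hrad n)

/-- The lattice neighbourhood `B_{n,k}`. -/
noncomputable def Bnk (Ω : Set (EuclideanSpace ℝ (Fin 2))) (Cw : ℝ) (n : ℕ)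
    (k : Fin 2 → ℤ) : Set (Fin 2 → ℤ) :=
  {l ∈ Kn Ω Cw n | ‖(2 : ℝ) ^ (-(n : ℤ)) • ivec l - (2 : ℝ) ^ (-(n : ℤ)) • ivec k‖ ≤ Hrad n}

/-- The truncated two-scale coefficient `ĉ_n[u;k] = min{M_n, max_{l ∈ B_{n,k}} c_n[u;l]}`. -/
noncomputable def chat (Ω : Set (EuclideanSpace ℝ (Fin 2)))
    (φ : Fin 2 → EuclideanSpace ℝ (Fin 2) → ℝ) (Cw α : ℝ)
    (u : EuclideanSpace ℝ (Fin 2) → ℝ) (n : ℕ) (k : Fin 2 → ℤ) : ℝ :=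
  min (Mthr α n) (⨆ (l : Fin 2 → ℤ) (_ : l ∈ Bnk Ω Cw n k), cn Ω φ u n l)

/-- The regularity energy `R_n(u) = 2^{−2n} Σ_{k ∈ 𝕂_n} ĉ_n[u;k]`. -/
noncomputable def Rn (Ω : Set (EuclideanSpace ℝ (Fin 2)))
    (φ : Fin 2 → EuclideanSpace ℝ (Fin 2) → ℝ) (Cw α : ℝ)
    (u : EuclideanSpace ℝ (Fin 2) → ℝ) (n : ℕ) : ℝ :=
  (2 : ℝ) ^ (-(2 * (n : ℤ))) * ∑' k : Kn Ω Cw n, chat Ω φ Cw α u n k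

section EnergyUpperBound

open Set Filter Topology Metric

section CurveGeometry

variable {γ : ℝ → EuclideanSpace ℝ (Fin 2)}

/-- A `C¹` curve is uniformly well approximated by its tangent lines on a compact interval. -/
lemma exists_uniform_tangent_approx (hγ : ContDiff ℝ 1 γ) (b : ℝ) {ε : ℝ} (hε : 0 < ε) :
    ∃ δ > 0, ∀ s t, 0 ≤ s → s ≤ t → t ≤ b → t - s < δ →
      ‖γ t - γ s - (t - s) • deriv γ s‖ ≤ ε * (t - s) := by
  have hc : Continuous (deriv γ) := hγ.continuous_deriv le_rfl
  have hu : UniformContinuousOn (deriv γ) (Icc 0 b) :=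
    isCompact_Icc.uniformContinuousOn_of_continuous hc.continuousOn
  obtain ⟨δ, hδ, h⟩ := Metric.uniformContinuousOn_iff.1 hu ε hε
  refine ⟨δ, hδ, fun s t hs hst htb hts => ?_⟩
  have hd : Differentiable ℝ γ := hγ.differentiable one_ne_zero
  have key := norm_image_sub_le_of_norm_deriv_le_segment' (a := s) (b := t)
    (f := fun x => γ x - x • deriv γ s) (f' := fun x => deriv γ x - deriv γ s) (C := ε)
    (fun x _ => by
      have h1 := (hd x).hasDerivAt
      have h2 : HasDerivAt (fun x : ℝ => x • deriv γ s) (deriv γ s) x := by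
        simpa using (hasDerivAt_id x).smul_const (deriv γ s)
      exact (h1.sub h2).hasDerivWithinAt)
    (fun x hx => by
      rw [← dist_eq_norm]
      refine (h x ⟨hs.trans hx.1, hx.2.le.trans htb⟩ s ⟨hs, hst.trans htb⟩ ?_).le
      rw [Real.dist_eq, abs_of_nonneg (by linarith [hx.1])]
      linarith [hx.2]) t (right_mem_Icc.2 hst)
  have hrw : γ t - t • deriv γ s - (γ s - s • deriv γ s) = γ t - γ s - (t - s) • deriv γ s := by
    module
  simpa only [hrw] using key

lemma volume_orthonormal_box (b : OrthonormalBasis (Fin 2) ℝ (EuclideanSpace ℝ (Fin 2)))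
    (p : EuclideanSpace ℝ (Fin 2)) (lo hi : Fin 2 → ℝ) :
    volume {y | ∀ i, b.repr (y - p) i ∈ Icc (lo i) (hi i)} =
      ∏ i, ENNReal.ofReal (hi i - lo i) := by
  rw [← Real.volume_Icc_pi]
  have h := ((PiLp.volume_preserving_ofLp (Fin 2)).comp b.measurePreserving_repr).comp
    (measurePreserving_sub_right (volume : Measure (EuclideanSpace ℝ (Fin 2))) p)
  rw [← h.measure_preimage measurableSet_Icc.nullMeasurableSet]
  congr 1
  ext y
  simp only [mem_ofPred_eq, mem_preimage, mem_Icc, Function.comp_apply, Pi.le_def]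
  exact forall_and

/-- The `ρ`-neighbourhood of an almost straight arc has almost the area of a rectangle. -/
lemma volume_thickened_arc_le {p e : EuclideanSpace ℝ (Fin 2)} (he : ‖e‖ = 1) {s ρ η : ℝ}
    (hs : 0 ≤ s) (hρ : 0 ≤ ρ) (hη : 0 ≤ η) :
    volume {y | ∃ τ ∈ Icc 0 s, ∃ q : EuclideanSpace ℝ (Fin 2), ‖q - p - τ • e‖ ≤ η ∧ dist y q ≤ ρ} ≤
      ENNReal.ofReal ((s + 2 * (ρ + η)) * (2 * (ρ + η))) := by
  have hon : Orthonormal ℝ (({0} : Set (Fin 2)).domRestrict (fun _ : Fin 2 => e)) := by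
    refine ⟨fun _ => he, fun i j hij => (hij (Subsingleton.elim i j)).elim⟩
  obtain ⟨b, hb⟩ := hon.exists_orthonormalBasis_extension_of_card_eq (by simp)
  have hb0 : b 0 = e := hb 0 rfl
  have hrep : b.repr e = EuclideanSpace.single 0 1 := by rw [← hb0, b.repr_self]
  have hbox := volume_orthonormal_box b p ![-(ρ + η), -(ρ + η)] ![s + (ρ + η), ρ + η]
  have hprod : ∏ i, ENNReal.ofReal ((![s + (ρ + η), ρ + η] : Fin 2 → ℝ) i
      - (![-(ρ + η), -(ρ + η)] : Fin 2 → ℝ) i) =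
      ENNReal.ofReal ((s + 2 * (ρ + η)) * (2 * (ρ + η))) := by
    rw [ENNReal.ofReal_mul (by positivity), Fin.prod_univ_two]
    simp only [Matrix.cons_val_zero, Matrix.cons_val_one]
    congr 2 <;> ring
  rw [← hprod, ← hbox]
  refine measure_mono ?_
  rintro y ⟨τ, hτ, q, hq, hy⟩ i
  have hcoord : ∀ (v : EuclideanSpace ℝ (Fin 2)), |b.repr v i| ≤ ‖v‖ := fun v => by
    have := PiLp.norm_apply_le (b.repr v) i
    rwa [LinearIsometryEquiv.norm_map, Real.norm_eq_abs] at this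
  have h1 := abs_le.1 ((hcoord (y - q)).trans ((dist_eq_norm y q).ge.trans hy))
  have h2 := abs_le.1 ((hcoord (q - p - τ • e)).trans hq)
  have hdec : b.repr (y - p) i = b.repr (y - q) i + b.repr (q - p - τ • e) i
      + τ * (EuclideanSpace.single (0 : Fin 2) (1 : ℝ) : EuclideanSpace ℝ (Fin 2)) i := by
    rw [← hrep]
    have : y - p = (y - q) + (q - p - τ • e) + τ • e := by module
    rw [this]
    simp
  rw [hdec]
  obtain ⟨hτ0, hτs⟩ := hτ
  fin_cases i
  · simp at h1 h2 ⊢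
    constructor <;> linarith
  · simp at h1 h2 ⊢
    constructor <;> linarith

/-- Upper Minkowski content of a unit-speed `C¹` arc. -/
lemma volume_tube_curve_le (hγ : ContDiff ℝ 1 γ) (hunit : ∀ t, ‖deriv γ t‖ = 1) {b : ℝ}
    (hb : 0 < b) {η : ℝ} (hη : 0 < η) :
    ∀ᶠ ρ in 𝓝[>] (0 : ℝ), volume {y | ∃ p ∈ γ '' Icc 0 b, dist y p ≤ ρ} ≤
      ENNReal.ofReal (2 * ρ * (b + η)) := by
  obtain ⟨x, hx0, hx1, hxlim⟩ : ∃ x : ℝ, 0 < x ∧ x < 1 ∧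
      (b + x) * (1 + 4 * x) * (1 + x) < b + η := by
    have hcont : Tendsto (fun x : ℝ => (b + x) * (1 + 4 * x) * (1 + x)) (𝓝[>] 0)
        (𝓝 ((b + 0) * (1 + 4 * 0) * (1 + 0))) :=
      (Continuous.tendsto (by fun_prop) 0).mono_left nhdsWithin_le_nhds
    have h1 := hcont.eventually (gt_mem_nhds (show (b + 0) * (1 + 4 * 0) * (1 + 0) < b + η by
      simpa using hη))
    have h2 : ∀ᶠ x : ℝ in 𝓝[>] 0, x ∈ Ioo (0 : ℝ) 1 := Ioo_mem_nhdsGT one_pos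
    obtain ⟨x, hx, hx'⟩ := (h1.and h2).exists
    exact ⟨x, hx'.1, hx'.2, hx⟩
  obtain ⟨δ, hδ, happ⟩ := exists_uniform_tangent_approx hγ (b + 1) (ε := x ^ 2) (by positivity)
  have hmem : Ioo (0 : ℝ) (x * min (x * 1) (δ / 2)) ∈ 𝓝[>] (0 : ℝ) :=
    Ioo_mem_nhdsGT (by positivity)
  filter_upwards [hmem] with ρ hρ
  obtain ⟨hρ0, hρ1⟩ := hρ
  set s : ℝ := ρ / x with hs
  have hs0 : 0 < s := by positivity
  have hsx : s < min (x * 1) (δ / 2) := by rw [hs, div_lt_iff₀ hx0]; linarith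
  have hsx1 : s < x := by have := hsx.trans_le (min_le_left _ _); linarith
  have hsδ : s < δ := by have := hsx.trans_le (min_le_right _ _); linarith
  have hρs : ρ = x * s := by rw [hs]; field_simp
  set N : ℕ := ⌊b / s⌋₊ + 1 with hN
  have hNle : (N : ℝ) * s ≤ b + s := by
    have h := Nat.floor_le (show 0 ≤ b / s by positivity)
    rw [hN]; push_cast
    have : (⌊b / s⌋₊ : ℝ) * s ≤ b := by
      calc (⌊b / s⌋₊ : ℝ) * s ≤ b / s * s := by gcongr
        _ = b := by field_simp
    linarith
  have hsub : {y | ∃ p ∈ γ '' Icc 0 b, dist y p ≤ ρ} ⊆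
      ⋃ i ∈ Finset.range N, {y | ∃ τ ∈ Icc 0 s, ∃ q : EuclideanSpace ℝ (Fin 2),
        ‖q - γ (i * s) - τ • deriv γ (i * s)‖ ≤ x ^ 2 * s ∧ dist y q ≤ ρ} := by
    rintro y ⟨_, ⟨t, ht, rfl⟩, hy⟩
    simp only [mem_iUnion, Finset.mem_range]
    have hts : 0 ≤ t / s := div_nonneg ht.1 hs0.le
    have hfl : (⌊t / s⌋₊ : ℝ) * s ≤ t := by
      rw [← le_div_iff₀ hs0]; exact Nat.floor_le hts
    have hfl' : t < ((⌊t / s⌋₊ : ℝ) + 1) * s := by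
      rw [← div_lt_iff₀ hs0]; exact Nat.lt_floor_add_one _
    refine ⟨⌊t / s⌋₊, ?_, t - ⌊t / s⌋₊ * s, ⟨by linarith, by linarith⟩, γ t, ?_, hy⟩
    · rw [hN, Nat.lt_succ_iff]
      exact Nat.floor_le_floor (by gcongr; exact ht.2)
    · refine (happ _ t (by positivity) hfl (by linarith [ht.2]) (by linarith)).trans ?_
      gcongr
      linarith
  calc volume {y | ∃ p ∈ γ '' Icc 0 b, dist y p ≤ ρ}
      ≤ ∑ i ∈ Finset.range N, ENNReal.ofReal
          ((s + 2 * (ρ + x ^ 2 * s)) * (2 * (ρ + x ^ 2 * s))) :=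
        (measure_mono hsub).trans ((measure_biUnion_finset_le _ _).trans
          (Finset.sum_le_sum fun i _ =>
            volume_thickened_arc_le (hunit _) hs0.le hρ0.le (by positivity)))
    _ = ENNReal.ofReal (N * ((s + 2 * (ρ + x ^ 2 * s)) * (2 * (ρ + x ^ 2 * s)))) := by
        rw [Finset.sum_const, Finset.card_range, nsmul_eq_mul,
          ENNReal.ofReal_mul (Nat.cast_nonneg _), ENNReal.ofReal_natCast]
    _ ≤ ENNReal.ofReal (2 * ρ * (b + η)) := by
        refine ENNReal.ofReal_le_ofReal ?_
        have e1 : (N : ℝ) * ((s + 2 * (ρ + x ^ 2 * s)) * (2 * (ρ + x ^ 2 * s))) =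
            2 * ρ * (((N : ℝ) * s) * (1 + 2 * x + 2 * x ^ 2) * (1 + x)) := by
          rw [hρs]; ring
        rw [e1]
        gcongr
        refine le_trans ?_ hxlim.le
        have h2 : 1 + 2 * x + 2 * x ^ 2 ≤ 1 + 4 * x := by nlinarith
        have h3 : (N : ℝ) * s ≤ b + x := by linarith
        gcongr

/-- The image of a half-open interval has `ℋ¹`-measure at least the length of its chord. -/
lemma dist_le_hausdorffMeasure_image_Ico (hγ : Continuous γ) {s t : ℝ} (hst : s ≤ t) :
    ENNReal.ofReal (dist (γ t) (γ s)) ≤ μH[1] (γ '' Ico s t) := by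
  have hlip : LipschitzWith 1 (fun x => dist x (γ s)) := LipschitzWith.dist_left _
  have h1 := hlip.hausdorffMeasure_image_le zero_le_one (γ '' Ico s t)
  simp only [ENNReal.coe_one, ENNReal.one_rpow, one_mul] at h1
  refine le_trans ?_ h1
  have h2 := intermediate_value_Ico hst (f := fun x => dist (γ x) (γ s)) (by fun_prop)
  rw [hausdorffMeasure_real, image_image]
  refine le_trans (le_of_eq ?_) (measure_mono h2)
  simp

lemma le_hausdorffMeasure_curve (hγ : ContDiff ℝ 1 γ) (hunit : ∀ t, ‖deriv γ t‖ = 1) {b : ℝ}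
    (hb : 0 < b) (hinj : InjOn γ (Icc 0 b)) : ENNReal.ofReal b ≤ μH[1] (γ '' Icc 0 b) := by
  have hε : ∀ ε ∈ Ioo (0 : ℝ) 1, ENNReal.ofReal ((1 - ε) * b) ≤ μH[1] (γ '' Icc 0 b) := by
    rintro ε ⟨hε0, hε1⟩
    obtain ⟨δ, hδ, happ⟩ := exists_uniform_tangent_approx hγ b hε0
    obtain ⟨N, hN⟩ := exists_nat_gt (b / δ)
    have hN0 : (0 : ℝ) < N := lt_trans (by positivity) hN
    set s : ℝ := b / N with hs
    have hs0 : 0 < s := by positivity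
    have hsδ : s < δ := by
      rw [hs, div_lt_iff₀ hN0]; rw [div_lt_iff₀ hδ] at hN; linarith
    have hNs : (N : ℝ) * s = b := by rw [hs]; field_simp
    have hpiece : ∀ i ∈ Finset.range N, Ico (i * s) ((i + 1) * s) ⊆ Icc 0 b := by
      intro i hi x hx
      have hi' : (i : ℝ) + 1 ≤ N := by exact_mod_cast Finset.mem_range.1 hi
      have : ((i : ℝ) + 1) * s ≤ N * s := by gcongr
      exact ⟨le_trans (by positivity) hx.1, by linarith [hx.2]⟩
    have hlow : ∀ i ∈ Finset.range N,
        ENNReal.ofReal ((1 - ε) * s) ≤ μH[1] (γ '' Ico (i * s) ((i + 1) * s)) := by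
      intro i hi
      have hi' : (i : ℝ) + 1 ≤ N := by exact_mod_cast Finset.mem_range.1 hi
      have hle : ((i : ℝ) + 1) * s ≤ N * s := by gcongr
      refine le_trans (ENNReal.ofReal_le_ofReal ?_)
        (dist_le_hausdorffMeasure_image_Ico hγ.continuous (by linarith))
      have h := happ (i * s) ((i + 1) * s) (by positivity) (by linarith) (by linarith)
        (by linarith)
      have hd : ((i : ℝ) + 1) * s - i * s = s := by ring
      rw [hd] at h
      have h2 : ‖s • deriv γ (i * s)‖ = s := by
        rw [norm_smul, hunit, mul_one, Real.norm_of_nonneg hs0.le]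
      have h3 := norm_sub_norm_le (s • deriv γ (i * s)) (γ ((i + 1) * s) - γ (i * s))
      rw [norm_sub_rev (s • deriv γ (i * s))] at h3
      rw [dist_eq_norm]
      linarith
    have hdisj : Set.PairwiseDisjoint (Finset.range N : Set ℕ)
        (fun i : ℕ => γ '' Ico (i * s) ((i + 1) * s)) := by
      intro i hi j hj hij
      rw [Function.onFun, disjoint_iff_inter_eq_empty,
        ← hinj.image_inter (hpiece i hi) (hpiece j hj), image_eq_empty, ← disjoint_iff_inter_eq_empty, Set.disjoint_left]
      rintro x hx hx'
      rcases lt_or_gt_of_ne hij with h | h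
      · have : (i : ℝ) + 1 ≤ j := by exact_mod_cast h
        have : ((i : ℝ) + 1) * s ≤ j * s := by gcongr
        linarith [hx.2, hx'.1]
      · have : (j : ℝ) + 1 ≤ i := by exact_mod_cast h
        have : ((j : ℝ) + 1) * s ≤ i * s := by gcongr
        linarith [hx.1, hx'.2]
    have hmeas : ∀ i ∈ Finset.range N, MeasurableSet (γ '' Ico (i * s) ((i + 1) * s)) :=
      fun i hi => measurableSet_Ico.image_of_continuousOn_injOn hγ.continuous.continuousOn
        (hinj.mono (hpiece i hi))
    calc ENNReal.ofReal ((1 - ε) * b)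
        = ∑ i ∈ Finset.range N, ENNReal.ofReal ((1 - ε) * s) := by
          rw [Finset.sum_const, Finset.card_range, nsmul_eq_mul, ← ENNReal.ofReal_natCast,
            ← ENNReal.ofReal_mul (Nat.cast_nonneg _), ← hNs]
          congr 1; ring
      _ ≤ ∑ i ∈ Finset.range N, μH[1] (γ '' Ico (i * s) ((i + 1) * s)) :=
          Finset.sum_le_sum hlow
      _ = μH[1] (⋃ i ∈ Finset.range N, γ '' Ico (i * s) ((i + 1) * s)) :=
          (measure_biUnion_finset hdisj hmeas).symm
      _ ≤ μH[1] (γ '' Icc 0 b) :=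
          measure_mono (iUnion₂_subset fun i hi => image_mono (hpiece i hi))
  have hlim : Tendsto (fun ε : ℝ => ENNReal.ofReal ((1 - ε) * b)) (𝓝[>] 0)
      (𝓝 (ENNReal.ofReal ((1 - 0) * b))) :=
    ((ENNReal.continuous_ofReal.comp (by fun_prop : Continuous fun ε : ℝ => (1 - ε) * b)).tendsto
      0).mono_left nhdsWithin_le_nhds
  rw [sub_zero, one_mul] at hlim
  exact le_of_tendsto hlim (mem_of_superset (Ioo_mem_nhdsGT one_pos) hε)

lemma hausdorffMeasure_curve_ne_top (hγ : ContDiff ℝ 1 γ) (hunit : ∀ t, ‖deriv γ t‖ = 1) (b : ℝ) :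
    μH[1] (γ '' Icc 0 b) ≠ ∞ := by
  have hlip : LipschitzWith 1 γ := lipschitzWith_of_nnnorm_deriv_le
    (hγ.differentiable one_ne_zero) fun t => by
      rw [← NNReal.coe_le_coe, coe_nnnorm, hunit]; simp
  have h := hlip.hausdorffMeasure_image_le zero_le_one (Icc 0 b)
  rw [hausdorffMeasure_real, Real.volume_Icc] at h
  exact ne_top_of_le_ne_top (by simp) h

end CurveGeometry

/-- The upper Minkowski content of a simple curve union is at most its length. -/
lemma IsSimpleCurveUnion.volume_tube_le {Γ : Set (EuclideanSpace ℝ (Fin 2))}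
    (hΓ : IsSimpleCurveUnion Γ) {η : ℝ} (hη : 0 < η) :
    ∀ᶠ ρ in 𝓝[>] (0 : ℝ), volume {y | ∃ p ∈ Γ, dist y p ≤ ρ} ≤
      ENNReal.ofReal (2 * ρ * ((μH[1] Γ).toReal + η)) := by
  obtain ⟨K, γ, b, hb, hγ, hunit, hinj, hdisj, rfl⟩ := hΓ
  have hmeas : ∀ i, MeasurableSet (γ i '' Icc 0 (b i)) := fun i =>
    (isCompact_Icc.image (hγ i).continuous).isClosed.measurableSet
  have hH : μH[1] (⋃ i, γ i '' Icc 0 (b i)) = ∑ i, μH[1] (γ i '' Icc 0 (b i)) := by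
    rw [measure_iUnion (fun i j hij => hdisj i j hij) hmeas, tsum_fintype]
  have hlen : ∑ i, b i ≤ (μH[1] (⋃ i, γ i '' Icc 0 (b i))).toReal := by
    rw [hH, ENNReal.toReal_sum fun i _ => hausdorffMeasure_curve_ne_top (hγ i) (hunit i) _]
    refine Finset.sum_le_sum fun i _ => ?_
    rw [← ENNReal.ofReal_le_iff_le_toReal (hausdorffMeasure_curve_ne_top (hγ i) (hunit i) _)]
    exact le_hausdorffMeasure_curve (hγ i) (hunit i) (hb i) (hinj i)
  have hη' : 0 < η / (K + 1) := by positivity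
  have hall := eventually_all.2 fun i => volume_tube_curve_le (hγ i) (hunit i) (hb i) hη'
  filter_upwards [hall, self_mem_nhdsWithin] with ρ hρ hρ0
  rw [mem_Ioi] at hρ0
  have hsub : {y | ∃ p ∈ ⋃ i, γ i '' Icc 0 (b i), dist y p ≤ ρ} ⊆
      ⋃ i, {y | ∃ p ∈ γ i '' Icc 0 (b i), dist y p ≤ ρ} := by
    rintro y ⟨p, hp, hy⟩
    obtain ⟨i, hi⟩ := mem_iUnion.1 hp
    exact mem_iUnion.2 ⟨i, p, hi, hy⟩
  calc volume {y | ∃ p ∈ ⋃ i, γ i '' Icc 0 (b i), dist y p ≤ ρ}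
      ≤ ∑ i, ENNReal.ofReal (2 * ρ * (b i + η / (K + 1))) :=
        (measure_mono hsub).trans ((measure_iUnion_fintype_le _ _).trans
          (Finset.sum_le_sum fun i _ => hρ i))
    _ = ENNReal.ofReal (∑ i, 2 * ρ * (b i + η / (K + 1))) :=
        (ENNReal.ofReal_sum_of_nonneg fun i _ => by have := hb i; positivity).symm
    _ ≤ _ := by
        refine ENNReal.ofReal_le_ofReal ?_
        rw [← Finset.mul_sum, Finset.sum_add_distrib]
        gcongr
        simp only [Finset.sum_const, Finset.card_univ, Fintype.card_fin, nsmul_eq_mul]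
        rw [mul_div_assoc', div_le_iff₀ (by positivity)]
        nlinarith

section Coefficients

lemma continuousOn_pd {U : Set (EuclideanSpace ℝ (Fin 2))} (hU : IsOpen U)
    {u : EuclideanSpace ℝ (Fin 2) → ℝ} (hu : ContDiffOn ℝ 1 u U) (j : Fin 2) :
    ContinuousOn (pd j u) U :=
  (hu.continuousOn_fderiv_of_isOpen hU le_rfl).clm_apply continuousOn_const

lemma integrable_mul_of_tsupport_subset {U : Set (EuclideanSpace ℝ (Fin 2))} (hU : IsOpen U)
    {v ψ : EuclideanSpace ℝ (Fin 2) → ℝ} (hv : ContinuousOn v U) (hψ : Continuous ψ)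
    (hc : HasCompactSupport ψ) (hsub : tsupport ψ ⊆ U) : Integrable (fun x => v x * ψ x) :=
  ((hv.mul hψ.continuousOn).continuous_of_tsupport_subset hU
    (tsupport_mul_subset_right.trans hsub)).integrable_of_hasCompactSupport hc.mul_left

/-- If the window of `c_{n,j}[u;l]` lies in an open set where `u` is `C¹`, the coefficient is an
average of `∂_j u` over that window. -/
lemma abs_cnj_sub_le {Ω U : Set (EuclideanSpace ℝ (Fin 2))} (hU : IsOpen U) (hUΩ : U ⊆ Ω)
    {φ : Fin 2 → EuclideanSpace ℝ (Fin 2) → ℝ} {Cw : ℝ} {j : Fin 2}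
    (hφC1 : ContDiff ℝ 1 (φ j)) (hφnonneg : ∀ y, 0 ≤ φ j y) (hφne : ∃ y, φ j y ≠ 0)
    (hφsupp : Function.support (φ j) ⊆ closedBall (0 : EuclideanSpace ℝ (Fin 2)) Cw)
    {u : EuclideanSpace ℝ (Fin 2) → ℝ} (hu : ContDiffOn ℝ 1 u U) {n : ℕ} {l : Fin 2 → ℤ}
    (hball : closedBall ((2 : ℝ) ^ (-(n : ℤ)) • ivec l) ((2 : ℝ) ^ (-((n : ℤ) - 1)) * Cw) ⊆ U)
    {a ε : ℝ}
    (hbd : ∀ x ∈ closedBall ((2 : ℝ) ^ (-(n : ℤ)) • ivec l) ((2 : ℝ) ^ (-((n : ℤ) - 1)) * Cw),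
      |pd j u x - a| ≤ ε) :
    |cnj Ω φ u n j l - a| ≤ ε := by
  set z : EuclideanSpace ℝ (Fin 2) := (2 : ℝ) ^ (-(n : ℤ)) • ivec l with hz
  set m : ℝ := (2 : ℝ) ^ ((n : ℤ) - 1) with hm
  have hm0 : 0 < m := by positivity
  have hmi : (2 : ℝ) ^ (-((n : ℤ) - 1)) = m⁻¹ := by rw [hm, zpow_neg]
  have hm2 : (2 : ℝ) ^ (2 * ((n : ℤ) - 1)) = m ^ 2 := by
    rw [hm, mul_comm, zpow_mul]; norm_cast
  rw [hmi] at hball hbd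
  set e : EuclideanSpace ℝ (Fin 2) := EuclideanSpace.single j 1 with he
  let ψ : EuclideanSpace ℝ (Fin 2) → ℝ := fun x => φ j (m • (x - z))
  have hψC1 : ContDiff ℝ 1 ψ :=
    hφC1.comp ((contDiff_id.sub contDiff_const).const_smul m)
  have hψsupp : Function.support ψ ⊆ closedBall z (m⁻¹ * Cw) := by
    intro x hx
    have h := hφsupp (show m • (x - z) ∈ Function.support (φ j) from hx)
    rw [mem_closedBall_zero_iff, norm_smul, Real.norm_of_nonneg hm0.le] at h
    rw [mem_closedBall, dist_eq_norm, inv_mul_eq_div, le_div_iff₀ hm0]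
    linarith
  have hψt : tsupport ψ ⊆ closedBall z (m⁻¹ * Cw) := closure_minimal hψsupp isClosed_closedBall
  have hψc : HasCompactSupport ψ :=
    HasCompactSupport.of_support_subset_isCompact (isCompact_closedBall _ _) hψsupp
  have hψd : ∀ x, fderiv ℝ ψ x e = m * pd j (φ j) (m • (x - z)) := by
    intro x
    have h1 : HasFDerivAt (fun x : EuclideanSpace ℝ (Fin 2) => m • (x - z))
        (m • ContinuousLinearMap.id ℝ (EuclideanSpace ℝ (Fin 2))) x :=
      ((hasFDerivAt_id x).sub_const z).const_smul m
    have h2 := ((hφC1.differentiable one_ne_zero (m • (x - z))).hasFDerivAt).comp x h1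
    have h3 : fderiv ℝ ψ x = _ := h2.fderiv
    rw [h3]
    simp [pd, he]
  have hIφ : 0 < ∫ y, φ j y := by
    refine hφC1.continuous.integral_pos_of_hasCompactSupport_nonneg_nonzero
      (HasCompactSupport.of_support_subset_isCompact (isCompact_closedBall _ _) hφsupp)
      hφnonneg hφne.choose_spec
  have hIψ : ∫ x, ψ x = (m ^ 2)⁻¹ * ∫ y, φ j y := by
    have h1 := integral_sub_right_eq_self (μ := (volume : Measure (EuclideanSpace ℝ (Fin 2))))
      (fun x => φ j (m • x)) z
    have h2 := Measure.integral_comp_smul_of_nonneg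
      (volume : Measure (EuclideanSpace ℝ (Fin 2))) (φ j) m (hR := hm0.le)
    rw [finrank_euclideanSpace_fin, smul_eq_mul] at h2
    exact h1.trans h2
  have h_integrable : Integrable (fun x => pd j u x * ψ x) :=
    integrable_mul_of_tsupport_subset hU (continuousOn_pd hU hu j) hψC1.continuous hψc
      (hψt.trans hball)
  have hint2 : Integrable (fun x => u x * fderiv ℝ ψ x e) :=
    integrable_mul_of_tsupport_subset hU hu.continuousOn
      ((hψC1.continuous_fderiv one_ne_zero).clm_apply continuous_const) (hψc.fderiv_apply ℝ e)
      ((tsupport_fderiv_apply_subset ℝ e).trans (hψt.trans hball))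
  have hint3 : Integrable (fun x => u x * ψ x) :=
    integrable_mul_of_tsupport_subset hU hu.continuousOn hψC1.continuous hψc (hψt.trans hball)
  have hintψ : Integrable ψ := hψC1.continuous.integrable_of_hasCompactSupport hψc
  have hparts : ∫ x, u x * fderiv ℝ ψ x e = -∫ x, pd j u x * ψ x :=
    integral_mul_fderiv_eq_neg_fderiv_mul_of_integrable h_integrable hint2 hint3
      (fun x hx => (hu.differentiableOn one_ne_zero).differentiableAt
        (hU.mem_nhds (hball (hψt hx))))
      (fun x _ => hψC1.differentiable one_ne_zero x)
  have hset : ∫ x in Ω, u x * (m ^ 2 * pd j (φ j) (m • (x - z))) =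
      m * ∫ x, u x * fderiv ℝ ψ x e := by
    rw [← integral_const_mul, setIntegral_eq_integral_of_forall_compl_eq_zero]
    · refine integral_congr_ae (Eventually.of_forall fun x => ?_)
      simp only [hψd]
      ring
    · intro x hx
      have h0 : fderiv ℝ ψ x e = 0 := by
        rw [fderiv_of_notMem_tsupport ℝ fun h => hx (hUΩ (hball (hψt h)))]
        rfl
      rw [hψd, mul_eq_zero] at h0
      rw [h0.resolve_left hm0.ne']
      ring
  have hcnj : cnj Ω φ u n j l - a = (∫ y, φ j y)⁻¹ * m ^ 2 * ∫ x, (pd j u x - a) * ψ x := by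
    have h1 : ∫ x, (pd j u x - a) * ψ x = (∫ x, pd j u x * ψ x) - a * ∫ x, ψ x := by
      rw [← integral_const_mul, ← integral_sub h_integrable (hintψ.const_mul a)]
      congr 1
      ext x
      ring
    have h2 : cnj Ω φ u n j l = -((∫ y, φ j y)⁻¹) * m *
        ∫ x in Ω, u x * (m ^ 2 * pd j (φ j) (m • (x - z))) := by
      rw [← hm2]
      rfl
    rw [h2, hset, hparts, h1, hIψ]
    field_simp
  have hle : |∫ x, (pd j u x - a) * ψ x| ≤ ∫ x, ε * ψ x := by
    rw [← Real.norm_eq_abs]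
    refine norm_integral_le_of_norm_le (hintψ.const_mul ε) (Eventually.of_forall fun x => ?_)
    by_cases hx : ψ x = 0
    · simp [hx]
    · rw [norm_mul, Real.norm_eq_abs, Real.norm_of_nonneg (hφnonneg _)]
      exact mul_le_mul_of_nonneg_right (hbd x (hψsupp hx)) (hφnonneg _)
  rw [integral_const_mul, hIψ] at hle
  rw [hcnj, abs_mul, abs_of_pos (by positivity)]
  calc (∫ y, φ j y)⁻¹ * m ^ 2 * |∫ x, (pd j u x - a) * ψ x|
      ≤ (∫ y, φ j y)⁻¹ * m ^ 2 * (ε * ((m ^ 2)⁻¹ * ∫ y, φ j y)) := by gcongr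
    _ = ε := by field_simp

lemma sqrt_sq_add_sq_le_of_abs_sub_le {c₀ c₁ a₀ a₁ ε : ℝ} (h₀ : |c₀ - a₀| ≤ ε)
    (h₁ : |c₁ - a₁| ≤ ε) :
    √(c₀ ^ 2 + c₁ ^ 2) ≤ √(a₀ ^ 2 + a₁ ^ 2) + 2 * ε := by
  have hε : 0 ≤ ε := (abs_nonneg _).trans h₀
  set S := √(a₀ ^ 2 + a₁ ^ 2) with hS
  have hS0 : 0 ≤ S := Real.sqrt_nonneg _
  have hS2 : S ^ 2 = a₀ ^ 2 + a₁ ^ 2 := Real.sq_sqrt (by positivity)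
  have ha₀ : |a₀| ≤ S := Real.abs_le_sqrt (by nlinarith)
  have ha₁ : |a₁| ≤ S := Real.abs_le_sqrt (by nlinarith)
  have key : ∀ {c a : ℝ}, |c - a| ≤ ε → |a| ≤ S → c ^ 2 ≤ a ^ 2 + 2 * ε * S + ε ^ 2 := by
    intro c a hca ha
    have h1 : |c| ≤ |a| + ε := by
      have := abs_sub_abs_le_abs_sub c a
      linarith
    have h2 : |c| ^ 2 ≤ (|a| + ε) ^ 2 := by gcongr
    rw [sq_abs] at h2
    have h3 : |a| ^ 2 = a ^ 2 := sq_abs a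
    nlinarith [mul_le_mul_of_nonneg_left ha hε]
  refine Real.sqrt_le_iff.2 ⟨by positivity, ?_⟩
  nlinarith [key h₀ ha₀, key h₁ ha₁]

variable {Ω : Set (EuclideanSpace ℝ (Fin 2))} {φ : Fin 2 → EuclideanSpace ℝ (Fin 2) → ℝ}
  {Cw α : ℝ} {u : EuclideanSpace ℝ (Fin 2) → ℝ} {n : ℕ} {k : Fin 2 → ℤ}

lemma chat_nonneg (hα : 0 < α) : 0 ≤ chat Ω φ Cw α u n k := by
  refine le_min ?_ (Real.iSup_nonneg fun l => Real.iSup_nonneg fun _ => Real.sqrt_nonneg _)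
  rw [Mthr, Hrad]
  positivity

lemma chat_le_of_forall_cn_le {C : ℝ} (hC : 0 ≤ C) (h : ∀ l ∈ Bnk Ω Cw n k, cn Ω φ u n l ≤ C) :
    chat Ω φ Cw α u n k ≤ C :=
  (min_le_right _ _).trans (Real.iSup_le (fun l => Real.iSup_le (h l) hC) hC)

end Coefficients

section Lattice

/-- The index of the dyadic cell of side `2⁻ⁿ` that contains `y`. -/
noncomputable def dyadicIndex (n : ℕ) (y : EuclideanSpace ℝ (Fin 2)) : Fin 2 → ℤ :=
  fun i => ⌊(2 : ℝ) ^ n * y i⌋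

lemma measurable_dyadicIndex (n : ℕ) : Measurable (dyadicIndex n) := by
  refine measurable_pi_lambda _ fun i => Int.measurable_floor.comp ?_
  fun_prop

lemma dist_dyadicIndex_le (n : ℕ) (y : EuclideanSpace ℝ (Fin 2)) :
    dist y ((2 : ℝ) ^ (-(n : ℤ)) • ivec (dyadicIndex n y)) ≤ 2 * (2 : ℝ) ^ (-(n : ℤ)) := by
  have hp : (0 : ℝ) < 2 ^ n := by positivity
  have hh : (2 : ℝ) ^ (-(n : ℤ)) = (2 ^ n)⁻¹ := by rw [zpow_neg, zpow_natCast]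
  rw [hh]
  have hcoord : ∀ i, dist (y i) ((((2 : ℝ) ^ n)⁻¹ • ivec (dyadicIndex n y)) i) ≤ (2 ^ n)⁻¹ := by
    intro i
    have h1 : ((2 : ℝ) ^ n)⁻¹ * 2 ^ n = 1 := inv_mul_cancel₀ hp.ne'
    have h2 : y i - (((2 : ℝ) ^ n)⁻¹ • ivec (dyadicIndex n y)) i =
        (2 ^ n)⁻¹ * Int.fract ((2 : ℝ) ^ n * y i) := by
      simp only [PiLp.smul_apply, ivec, dyadicIndex, smul_eq_mul, Int.fract]
      rw [mul_sub, ← mul_assoc, h1, one_mul]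
    rw [Real.dist_eq, h2, abs_of_nonneg (mul_nonneg (by positivity) (Int.fract_nonneg _))]
    exact mul_le_of_le_one_right (by positivity) (Int.fract_lt_one _).le
  rw [EuclideanSpace.dist_eq, Fin.sum_univ_two, Real.sqrt_le_iff]
  refine ⟨by positivity, ?_⟩
  have h0 := pow_le_pow_left₀ dist_nonneg (hcoord 0) 2
  have h1 := pow_le_pow_left₀ dist_nonneg (hcoord 1) 2
  nlinarith [sq_nonneg (((2 : ℝ) ^ n)⁻¹)]

lemma volume_dyadicCell (n : ℕ) (k : Fin 2 → ℤ) :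
    volume (dyadicIndex n ⁻¹' {k}) = ENNReal.ofReal ((2 : ℝ) ^ (-(2 * (n : ℤ)))) := by
  have hp : (0 : ℝ) < 2 ^ n := by positivity
  have hset : dyadicIndex n ⁻¹' {k} = (@WithLp.ofLp 2 (Fin 2 → ℝ)) ⁻¹'
      (univ.pi fun i => Ico ((k i : ℝ) / 2 ^ n) (((k i : ℝ) + 1) / 2 ^ n)) := by
    ext y
    simp only [mem_preimage, mem_singleton_iff, Set.mem_pi, mem_univ, true_imp_iff, mem_Ico,
      funext_iff, dyadicIndex, Int.floor_eq_iff]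
    refine forall_congr' fun i => ?_
    rw [div_le_iff₀ hp, lt_div_iff₀ hp, mul_comm]
  rw [hset, (PiLp.volume_preserving_ofLp (Fin 2)).measure_preimage
    (MeasurableSet.univ_pi fun i => measurableSet_Ico).nullMeasurableSet, Real.volume_pi_Ico]
  have hlen : ∀ i, ((k i : ℝ) + 1) / 2 ^ n - (k i : ℝ) / 2 ^ n = (2 ^ n)⁻¹ := fun i => by
    field_simp; ring
  simp only [hlen, Fin.prod_univ_two]
  rw [← ENNReal.ofReal_mul (by positivity), mul_comm 2 (n : ℤ), ← neg_mul, zpow_mul, zpow_neg,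
    zpow_natCast]
  congr 1
  norm_cast
  ring

lemma measurableSet_dyadicCell (n : ℕ) (k : Fin 2 → ℤ) :
    MeasurableSet (dyadicIndex n ⁻¹' {k}) :=
  measurable_dyadicIndex n (measurableSet_singleton k)

lemma dyadic_card_le (n : ℕ) (S : Finset (Fin 2 → ℤ)) {T : Set (EuclideanSpace ℝ (Fin 2))}
    (hT : ∀ y, dyadicIndex n y ∈ S → y ∈ T) {c : ℝ} (hc : 0 ≤ c)
    (hTc : volume T ≤ ENNReal.ofReal c) : (2 : ℝ) ^ (-(2 * (n : ℤ))) * S.card ≤ c := by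
  rw [← ENNReal.ofReal_le_ofReal_iff hc]
  refine le_trans (le_of_eq ?_) ((measure_mono (show ⋃ k ∈ S, dyadicIndex n ⁻¹' {k} ⊆ T from
    iUnion₂_subset fun k hk y hy => hT y (by rwa [show dyadicIndex n y = k from hy]))).trans hTc)
  rw [measure_biUnion_finset (fun k _ l _ hkl => (disjoint_singleton.2 hkl).preimage _)
    fun k _ => measurableSet_dyadicCell n k]
  simp only [volume_dyadicCell, Finset.sum_const, nsmul_eq_mul]
  rw [mul_comm, ENNReal.ofReal_mul (by positivity), ENNReal.ofReal_natCast]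

open Classical in
lemma integral_dyadic (n : ℕ) (S : Finset (Fin 2 → ℤ)) (F : (Fin 2 → ℤ) → ℝ) :
    ∫ y, (if dyadicIndex n y ∈ S then F (dyadicIndex n y) else 0) =
      (2 : ℝ) ^ (-(2 * (n : ℤ))) * ∑ k ∈ S, F k := by
  have hfun : (fun y => if dyadicIndex n y ∈ S then F (dyadicIndex n y) else 0) =
      fun y => ∑ k ∈ S, (dyadicIndex n ⁻¹' {k}).indicator (fun _ => F k) y := by
    ext y
    simp only [indicator, mem_preimage, mem_singleton_iff]
    rw [Finset.sum_ite_eq]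
  rw [hfun, integral_finsetSum, Finset.mul_sum]
  · refine Finset.sum_congr rfl fun k _ => ?_
    rw [integral_indicator_const _ (measurableSet_dyadicCell n k), Measure.real,
      volume_dyadicCell, ENNReal.toReal_ofReal (by positivity), smul_eq_mul]
  · intro k _
    refine (integrable_indicator_iff (measurableSet_dyadicCell n k)).2
      (integrableOn_const ?_)
    rw [volume_dyadicCell]
    exact ENNReal.ofReal_ne_top

lemma smul_ivec_mem_of_mem_Kn {Ω : Set (EuclideanSpace ℝ (Fin 2))} {Cw : ℝ} (hCw : 0 < Cw) {n : ℕ}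
    {k : Fin 2 → ℤ} (hk : k ∈ Kn Ω Cw n) : (2 : ℝ) ^ (-(n : ℤ)) • ivec k ∈ Ω :=
  hk (mem_closedBall_self (by positivity))

lemma finite_Kn {Ω : Set (EuclideanSpace ℝ (Fin 2))} (hΩ : Bornology.IsBounded Ω) {Cw : ℝ}
    (hCw : 0 < Cw) (n : ℕ) : (Kn Ω Cw n).Finite := by
  obtain ⟨R, hR⟩ := hΩ.exists_norm_le
  refine (Set.finite_Icc (fun _ : Fin 2 => -⌈2 ^ n * R⌉) (fun _ => ⌈2 ^ n * R⌉)).subset ?_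
  intro k hk
  have hn := hR _ (smul_ivec_mem_of_mem_Kn hCw hk)
  have hcoord : ∀ i, |(k i : ℝ)| ≤ ⌈2 ^ n * R⌉ := by
    intro i
    have h1 := (PiLp.norm_apply_le ((2 : ℝ) ^ (-(n : ℤ)) • ivec k) i).trans hn
    rw [PiLp.smul_apply, smul_eq_mul, norm_mul, zpow_neg, zpow_natCast,
      Real.norm_of_nonneg (by positivity), inv_mul_le_iff₀ (by positivity)] at h1
    exact h1.trans (Int.le_ceil _)
  refine ⟨fun i => ?_, fun i => ?_⟩
  · have := (abs_le.1 (hcoord i)).1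
    exact_mod_cast this
  · have := (abs_le.1 (hcoord i)).2
    exact_mod_cast this

/-- By Lebesgue's density theorem, almost every point outside `Ω` eventually leaves the cells of
the admissible lattice. -/
lemma ae_eventually_dyadicIndex_notMem_Kn {Ω : Set (EuclideanSpace ℝ (Fin 2))} (hΩ : IsOpen Ω)
    {Cw : ℝ} (hCw : 0 < Cw) :
    ∀ᵐ y : EuclideanSpace ℝ (Fin 2), y ∉ Ω → ∀ᶠ n in atTop, dyadicIndex n y ∉ Kn Ω Cw n := by
  have h := IsUnifLocDoublingMeasure.ae_tendsto_measure_inter_div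
    (volume : Measure (EuclideanSpace ℝ (Fin 2))) Ωᶜ Cw⁻¹
  rw [ae_restrict_iff' hΩ.measurableSet.compl] at h
  filter_upwards [h] with y hy hyΩ
  have hδ : Tendsto (fun n : ℕ => (2 : ℝ) ^ (-((n : ℤ) - 1)) * Cw) atTop (𝓝[>] 0) := by
    refine tendsto_nhdsWithin_iff.2 ⟨?_, Eventually.of_forall fun n => ?_⟩
    · have h1 : Tendsto (fun n : ℕ => 2 * ((1 / 2 : ℝ) ^ n) * Cw) atTop (𝓝 (2 * 0 * Cw)) :=
        ((tendsto_pow_atTop_nhds_zero_of_lt_one (by norm_num) (by norm_num)).const_mul 2).mul_const _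
      rw [mul_zero, zero_mul] at h1
      refine h1.congr fun n => ?_
      rw [neg_sub, zpow_sub₀ two_ne_zero, zpow_one, zpow_natCast, one_div, inv_pow, div_eq_mul_inv]
    · exact mem_Ioi.2 (by positivity)
  have hlim := hy hyΩ (fun n : ℕ => (2 : ℝ) ^ (-(n : ℤ)) • ivec (dyadicIndex n y)) _ hδ
    (Eventually.of_forall fun n => by
      refine mem_closedBall.2 ((dist_dyadicIndex_le n y).trans (le_of_eq ?_))
      rw [neg_sub, zpow_sub₀ two_ne_zero, zpow_one, zpow_neg]
      field_simp)
  filter_upwards [hlim.eventually (lt_mem_nhds one_pos)] with n hn hK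
  have hempty : Ωᶜ ∩ closedBall ((2 : ℝ) ^ (-(n : ℤ)) • ivec (dyadicIndex n y))
      ((2 : ℝ) ^ (-((n : ℤ) - 1)) * Cw) = ∅ :=
    disjoint_iff_inter_eq_empty.1 (disjoint_compl_left_iff_subset.2 hK)
  rw [hempty] at hn
  simp at hn

end Lattice

section Scales

lemma Hrad_pos (n : ℕ) : 0 < Hrad n := by
  rw [Hrad]; positivity

lemma Hrad_sq (n : ℕ) : Hrad n ^ 2 = (2 : ℝ) ^ (-(n : ℤ)) := by
  rw [Hrad, ← Real.rpow_natCast, ← Real.rpow_mul zero_le_two, ← Real.rpow_intCast]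
  congr 1
  push_cast
  ring

lemma two_zpow_neg_sub_one (n : ℕ) : (2 : ℝ) ^ (-((n : ℤ) - 1)) = 2 * Hrad n ^ 2 := by
  rw [Hrad_sq, neg_sub, sub_eq_add_neg, zpow_add₀ two_ne_zero, zpow_one]

lemma tendsto_Hrad : Tendsto Hrad atTop (𝓝 0) := by
  have h : Tendsto (fun n : ℕ => ((2 : ℝ) ^ (-(1 / 2) : ℝ)) ^ n) atTop (𝓝 0) :=
    tendsto_pow_atTop_nhds_zero_of_lt_one (by positivity)
      (Real.rpow_lt_one_of_one_lt_of_neg one_lt_two (by norm_num))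
  refine h.congr fun n => ?_
  rw [Hrad, ← Real.rpow_natCast, ← Real.rpow_mul zero_le_two]
  congr 1
  ring

/-- A radius within which `ĉ_n[u;k]` sees `u`, enlarged by the diameter of a dyadic cell. -/
noncomputable def influenceRadius (Cw : ℝ) (n : ℕ) : ℝ := Hrad n + (2 * Cw + 2) * Hrad n ^ 2

lemma tendsto_add_mul_Hrad_sq {c : ℝ} (hc : 0 ≤ c) :
    Tendsto (fun n => Hrad n + c * Hrad n ^ 2) atTop (𝓝[>] 0) := by
  refine tendsto_nhdsWithin_iff.2 ⟨?_, Eventually.of_forall fun n => ?_⟩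
  · simpa using tendsto_Hrad.add ((tendsto_Hrad.pow 2).const_mul c)
  · have := Hrad_pos n
    exact mem_Ioi.2 (by positivity)

end Scales

section Energy

/-- The lattice point `2⁻ⁿk` is so close to `Γ` that `ĉ_n[u;k]` may be affected by `Γ`. -/
def IsNear (Γ : Set (EuclideanSpace ℝ (Fin 2))) (Cw : ℝ) (n : ℕ) (k : Fin 2 → ℤ) : Prop :=
  ∃ p ∈ Γ, dist ((2 : ℝ) ^ (-(n : ℤ)) • ivec k) p ≤ influenceRadius Cw n

/-- The contribution of the lattice points near the curves. -/
lemma IsSimpleCurveUnion.eventually_near_sum_le {Γ : Set (EuclideanSpace ℝ (Fin 2))}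
    (hΓ : IsSimpleCurveUnion Γ) {Cw α : ℝ} (hCw : 0 < Cw) (hα : 0 < α) {η : ℝ} (hη : 0 < η) :
    ∀ᶠ n : ℕ in atTop, ∀ S : Finset (Fin 2 → ℤ), (∀ k ∈ S, IsNear Γ Cw n k) →
      (2 : ℝ) ^ (-(2 * (n : ℤ))) * (S.card * Mthr α n) ≤
        α * (1 + (2 * Cw + 4) * Hrad n) * ((μH[1] Γ).toReal + η) := by
  have htube := (tendsto_add_mul_Hrad_sq (c := 2 * Cw + 4) (by positivity)).eventually
    (hΓ.volume_tube_le hη)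
  filter_upwards [htube] with n hn S hS
  have hH := Hrad_pos n
  have hcard := dyadic_card_le n S (fun y hy => ?_) (by positivity) hn
  · calc (2 : ℝ) ^ (-(2 * (n : ℤ))) * (S.card * Mthr α n)
        = (2 : ℝ) ^ (-(2 * (n : ℤ))) * S.card * (α / (2 * Hrad n)) := by rw [Mthr]; ring
      _ ≤ 2 * (Hrad n + (2 * Cw + 4) * Hrad n ^ 2) * ((μH[1] Γ).toReal + η) *
          (α / (2 * Hrad n)) := by gcongr
      _ = α * (1 + (2 * Cw + 4) * Hrad n) * ((μH[1] Γ).toReal + η) := by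
          field_simp
  · obtain ⟨p, hp, hd⟩ := hS _ hy
    refine ⟨p, hp, ?_⟩
    have h1 := dist_triangle y ((2 : ℝ) ^ (-(n : ℤ)) • ivec (dyadicIndex n y)) p
    have h2 := dist_dyadicIndex_le n y
    rw [← Hrad_sq] at h1 h2
    rw [← Hrad_sq, influenceRadius] at hd
    linarith

open Classical in
/-- The energy density carried by the lattice points away from `Γ`. -/
noncomputable def farDensity (Ω : Set (EuclideanSpace ℝ (Fin 2)))
    (φ : Fin 2 → EuclideanSpace ℝ (Fin 2) → ℝ) (Cw α : ℝ) (u : EuclideanSpace ℝ (Fin 2) → ℝ)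
    (Γ : Set (EuclideanSpace ℝ (Fin 2))) (n : ℕ) (y : EuclideanSpace ℝ (Fin 2)) : ℝ :=
  if dyadicIndex n y ∈ Kn Ω Cw n ∧ ¬ IsNear Γ Cw n (dyadicIndex n y) then
    chat Ω φ Cw α u n (dyadicIndex n y) else 0

variable {Ω Γ : Set (EuclideanSpace ℝ (Fin 2))} {φ : Fin 2 → EuclideanSpace ℝ (Fin 2) → ℝ}
  {Cw α : ℝ} {u : EuclideanSpace ℝ (Fin 2) → ℝ} {n : ℕ}

lemma measurable_farDensity : Measurable (farDensity Ω φ Cw α u Γ n) := by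
  classical
  exact (measurable_of_countable (fun k => if k ∈ Kn Ω Cw n ∧ ¬ IsNear Γ Cw n k then
    chat Ω φ Cw α u n k else 0)).comp (measurable_dyadicIndex n)

lemma farDensity_nonneg (hα : 0 < α) (y : EuclideanSpace ℝ (Fin 2)) :
    0 ≤ farDensity Ω φ Cw α u Γ n y := by
  rw [farDensity]
  split_ifs
  exacts [chat_nonneg hα, le_rfl]

lemma closedBall_subset_diff_of_not_isNear {k l : Fin 2 → ℤ} (hk : ¬ IsNear Γ Cw n k)
    (hl : l ∈ Bnk Ω Cw n k) :
    closedBall ((2 : ℝ) ^ (-(n : ℤ)) • ivec l) ((2 : ℝ) ^ (-((n : ℤ) - 1)) * Cw) ⊆ Ω \ Γ := by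
  intro x hx
  refine ⟨hl.1 hx, fun hxΓ => hk ⟨x, hxΓ, ?_⟩⟩
  have h1 := hl.2
  rw [← dist_eq_norm, dist_comm] at h1
  rw [mem_closedBall, dist_comm, two_zpow_neg_sub_one] at hx
  have h3 := dist_triangle ((2 : ℝ) ^ (-(n : ℤ)) • ivec k) ((2 : ℝ) ^ (-(n : ℤ)) • ivec l) x
  rw [influenceRadius]
  nlinarith [sq_nonneg (Hrad n)]

/-- Away from `Γ` the truncated coefficient is controlled by the gradient in a small
neighbourhood. -/
lemma chat_le_of_not_isNear (hU : IsOpen (Ω \ Γ)) (hφC1 : ∀ j, ContDiff ℝ 1 (φ j))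
    (hφnonneg : ∀ j y, 0 ≤ φ j y) (hφne : ∀ j, ∃ y, φ j y ≠ 0)
    (hφsupp : ∀ j, Function.support (φ j) ⊆ closedBall (0 : EuclideanSpace ℝ (Fin 2)) Cw)
    (hu : ContDiffOn ℝ 1 u (Ω \ Γ)) {k : Fin 2 → ℤ} (hk : ¬ IsNear Γ Cw n k)
    {a : Fin 2 → ℝ} {ε : ℝ} (hε : 0 ≤ ε)
    (hbd : ∀ x ∈ Ω \ Γ,
      dist x ((2 : ℝ) ^ (-(n : ℤ)) • ivec k) ≤ Hrad n + 2 * Cw * Hrad n ^ 2 →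
        ∀ j, |pd j u x - a j| ≤ ε) :
    chat Ω φ Cw α u n k ≤ √(a 0 ^ 2 + a 1 ^ 2) + 2 * ε := by
  refine chat_le_of_forall_cn_le (by positivity) fun l hl => ?_
  have hball := closedBall_subset_diff_of_not_isNear hk hl
  have hj : ∀ j, |cnj Ω φ u n j l - a j| ≤ ε := fun j =>
    abs_cnj_sub_le hU sdiff_subset (hφC1 j) (hφnonneg j) (hφne j) (hφsupp j) hu hball fun x hx => by
      refine hbd x (hball hx) ?_ j
      have h1 := hl.2
      rw [← dist_eq_norm] at h1
      rw [mem_closedBall, two_zpow_neg_sub_one] at hx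
      have h3 := dist_triangle x ((2 : ℝ) ^ (-(n : ℤ)) • ivec l) ((2 : ℝ) ^ (-(n : ℤ)) • ivec k)
      linarith
  exact sqrt_sq_add_sq_le_of_abs_sub_le (hj 0) (hj 1)

/-- The far density is asymptotically dominated by the gradient on `Ω \ Γ`. -/
lemma eventually_farDensity_le (hU : IsOpen (Ω \ Γ)) (hCw : 0 < Cw)
    (hφC1 : ∀ j, ContDiff ℝ 1 (φ j))
    (hφnonneg : ∀ j y, 0 ≤ φ j y) (hφne : ∀ j, ∃ y, φ j y ≠ 0)
    (hφsupp : ∀ j, Function.support (φ j) ⊆ closedBall (0 : EuclideanSpace ℝ (Fin 2)) Cw)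
    (hu : ContDiffOn ℝ 1 u (Ω \ Γ)) {y : EuclideanSpace ℝ (Fin 2)} (hy : y ∈ Ω \ Γ)
    {ε : ℝ} (hε : 0 < ε) :
    ∀ᶠ n in atTop, farDensity Ω φ Cw α u Γ n y ≤ √(pd 0 u y ^ 2 + pd 1 u y ^ 2) + 2 * ε := by
  have hcont : ∀ᶠ x in 𝓝 y, ∀ j, |pd j u x - pd j u y| < ε := by
    refine eventually_all.2 fun j => ?_
    have := ((continuousOn_pd hU hu j).continuousAt (hU.mem_nhds hy)).eventually
      (Metric.ball_mem_nhds _ hε)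
    exact this
  obtain ⟨δ, hδ, hball⟩ := Metric.eventually_nhds_iff.1 hcont
  have hsmall := ((tendsto_add_mul_Hrad_sq (c := 2 * Cw + 2) (by positivity)).mono_right
    nhdsWithin_le_nhds).eventually (gt_mem_nhds hδ)
  filter_upwards [hsmall] with n hn
  rw [farDensity]
  split_ifs with hcond
  · refine chat_le_of_not_isNear hU hφC1 hφnonneg hφne hφsupp hu hcond.2
      (a := fun j => pd j u y) hε.le fun x _ hxd j => (hball ?_ j).le
    have h1 := dist_triangle x ((2 : ℝ) ^ (-(n : ℤ)) • ivec (dyadicIndex n y)) y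
    have h2 := dist_dyadicIndex_le n y
    rw [dist_comm, ← Hrad_sq] at h2
    rw [← Hrad_sq] at h1 hxd
    linarith
  · positivity

lemma farDensity_le (hU : IsOpen (Ω \ Γ)) (hφC1 : ∀ j, ContDiff ℝ 1 (φ j))
    (hφnonneg : ∀ j y, 0 ≤ φ j y) (hφne : ∀ j, ∃ y, φ j y ≠ 0)
    (hφsupp : ∀ j, Function.support (φ j) ⊆ closedBall (0 : EuclideanSpace ℝ (Fin 2)) Cw)
    (hu : ContDiffOn ℝ 1 u (Ω \ Γ)) {B : ℝ} (hB0 : 0 ≤ B)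
    (hB : ∀ x ∈ Ω \ Γ, √(pd 0 u x ^ 2 + pd 1 u x ^ 2) ≤ B) (y : EuclideanSpace ℝ (Fin 2)) :
    farDensity Ω φ Cw α u Γ n y ≤ 2 * B := by
  rw [farDensity]
  split_ifs with hcond
  · have h := chat_le_of_not_isNear (α := α) hU hφC1 hφnonneg hφne hφsupp hu hcond.2 (a := 0) hB0
      fun x hx _ j => by
        rw [Pi.zero_apply, sub_zero]
        refine le_trans (Real.abs_le_sqrt ?_) (hB x hx)
        fin_cases j <;> simp <;> positivity
    simpa using h
  · positivity

lemma farDensity_eq_zero_of_mem (hCw : 0 < Cw) {y : EuclideanSpace ℝ (Fin 2)} (hy : y ∈ Γ) :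
    farDensity Ω φ Cw α u Γ n y = 0 := by
  rw [farDensity, if_neg]
  refine fun h => h.2 ⟨y, hy, ?_⟩
  have h2 := dist_dyadicIndex_le n y
  rw [dist_comm, ← Hrad_sq] at h2
  rw [influenceRadius, ← Hrad_sq]
  nlinarith [Hrad_pos n, sq_nonneg (Hrad n)]

lemma farDensity_eq_zero_of_lt_norm (hCw : 0 < Cw) {R : ℝ} (hR : ∀ x ∈ Ω, ‖x‖ ≤ R)
    {y : EuclideanSpace ℝ (Fin 2)} (hy : R + 2 < ‖y‖) : farDensity Ω φ Cw α u Γ n y = 0 := by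
  rw [farDensity, if_neg]
  intro h
  have h1 := hR _ (smul_ivec_mem_of_mem_Kn hCw h.1)
  have h2 := dist_dyadicIndex_le n y
  have h3 : (2 : ℝ) ^ (-(n : ℤ)) ≤ 1 := zpow_le_one_of_nonpos₀ one_le_two (by simp)
  rw [dist_eq_norm] at h2
  have h4 := norm_sub_norm_le y ((2 : ℝ) ^ (-(n : ℤ)) • ivec (dyadicIndex n y))
  linarith

lemma eventually_integral_farDensity_le (hΩ : IsOpen Ω) (hΩbdd : Bornology.IsBounded Ω)
    (hU : IsOpen (Ω \ Γ)) (hCw : 0 < Cw) (hα : 0 < α) (hφC1 : ∀ j, ContDiff ℝ 1 (φ j))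
    (hφnonneg : ∀ j y, 0 ≤ φ j y) (hφne : ∀ j, ∃ y, φ j y ≠ 0)
    (hφsupp : ∀ j, Function.support (φ j) ⊆ closedBall (0 : EuclideanSpace ℝ (Fin 2)) Cw)
    (hu : ContDiffOn ℝ 1 u (Ω \ Γ))
    (hgradbdd : ∃ B : ℝ, ∀ x ∈ Ω \ Γ, √(pd 0 u x ^ 2 + pd 1 u x ^ 2) ≤ B) {η : ℝ} (hη : 0 < η) :
    ∀ᶠ n in atTop, ∫ y, farDensity Ω φ Cw α u Γ n y ≤
      (∫ x in Ω \ Γ, √(pd 0 u x ^ 2 + pd 1 u x ^ 2)) + η := by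
  obtain ⟨B', hB'⟩ := hgradbdd
  set B := max B' 0 with hBdef
  have hB0 : 0 ≤ B := le_max_right _ _
  have hB : ∀ x ∈ Ω \ Γ, √(pd 0 u x ^ 2 + pd 1 u x ^ 2) ≤ B :=
    fun x hx => (hB' x hx).trans (le_max_left _ _)
  obtain ⟨R, hR⟩ := hΩbdd.exists_norm_le
  set h : EuclideanSpace ℝ (Fin 2) → ℝ :=
    (Ω \ Γ).indicator fun x => √(pd 0 u x ^ 2 + pd 1 u x ^ 2) with hh
  have hh0 : ∀ y, 0 ≤ h y := fun y => indicator_nonneg (fun x _ => Real.sqrt_nonneg _) y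
  have hh_integrable : Integrable h := by
    refine (integrable_indicator_iff hU.measurableSet).2 (Integrable.mono' (g := fun _ => B)
      (integrableOn_const ((measure_mono sdiff_subset).trans_lt hΩbdd.measure_lt_top).ne) ?_ ?_)
    · exact ((((continuousOn_pd hU hu 0).pow 2).add
        ((continuousOn_pd hU hu 1).pow 2)).sqrt).aestronglyMeasurable hU.measurableSet
    · filter_upwards [ae_restrict_mem hU.measurableSet] with x hx
      rw [Real.norm_of_nonneg (Real.sqrt_nonneg _)]
      exact hB x hx
  have hfle := fun n y => farDensity_le (n := n) (α := α) hU hφC1 hφnonneg hφne hφsupp hu hB0 hB y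
  set bound : EuclideanSpace ℝ (Fin 2) → ℝ :=
    (closedBall 0 (R + 2)).indicator fun _ => 2 * B with hbound
  have hboundint : Integrable bound :=
    (integrable_indicator_iff measurableSet_closedBall).2
      (integrableOn_const measure_closedBall_lt_top.ne)
  have hfbound : ∀ n y, farDensity Ω φ Cw α u Γ n y ≤ bound y := by
    intro n y
    by_cases hy : y ∈ closedBall (0 : EuclideanSpace ℝ (Fin 2)) (R + 2)
    · rw [hbound, indicator_of_mem hy]
      exact hfle n y
    · rw [hbound, indicator_of_notMem hy]
      rw [mem_closedBall_zero_iff, not_le] at hy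
      exact (farDensity_eq_zero_of_lt_norm hCw hR hy).le
  have hfint : ∀ n, Integrable (farDensity Ω φ Cw α u Γ n) := fun n =>
    hboundint.mono' measurable_farDensity.aestronglyMeasurable (Eventually.of_forall fun y => by
      rw [Real.norm_of_nonneg (farDensity_nonneg hα y)]
      exact hfbound n y)
  set F : ℕ → EuclideanSpace ℝ (Fin 2) → ℝ :=
    fun n y => max (farDensity Ω φ Cw α u Γ n y - h y) 0 with hF
  have hFbound : ∀ n y, ‖F n y‖ ≤ bound y := by
    intro n y
    rw [hF, Real.norm_of_nonneg (le_max_right _ _)]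
    exact max_le (by linarith [hfbound n y, hh0 y])
      ((farDensity_nonneg hα y).trans (hfbound n y))
  have hFmeas : ∀ n, AEStronglyMeasurable (F n) := fun n =>
    (((hfint n).sub hh_integrable).aestronglyMeasurable).sup aestronglyMeasurable_const
  have hFlim : ∀ᵐ y, Tendsto (fun n => F n y) atTop (𝓝 0) := by
    filter_upwards [ae_eventually_dyadicIndex_notMem_Kn hΩ hCw] with y hy
    by_cases hyΓ : y ∈ Γ
    · refine tendsto_const_nhds.congr fun n => ?_
      rw [hF]
      simp only [farDensity_eq_zero_of_mem hCw hyΓ, zero_sub]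
      rw [max_eq_right (neg_nonpos.2 (hh0 y))]
    by_cases hyΩ : y ∈ Ω
    · have hyU : y ∈ Ω \ Γ := ⟨hyΩ, hyΓ⟩
      refine Metric.tendsto_nhds.2 fun ε hε => ?_
      filter_upwards [eventually_farDensity_le (α := α) hU hCw hφC1 hφnonneg hφne hφsupp hu hyU
        (ε := ε / 4) (by positivity)] with n hn
      rw [Real.dist_0_eq_abs, hF, abs_of_nonneg (le_max_right _ _)]
      refine max_lt ?_ hε
      rw [hh, indicator_of_mem hyU]
      linarith
    · refine tendsto_const_nhds.congr' ?_
      filter_upwards [hy hyΩ] with n hn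
      rw [hF]
      simp only [farDensity, hn, false_and, if_false, zero_sub]
      rw [max_eq_right (neg_nonpos.2 (hh0 y))]
  have hlim := tendsto_integral_of_dominated_convergence bound hFmeas hboundint
    (fun n => Eventually.of_forall (hFbound n)) hFlim
  rw [integral_zero] at hlim
  filter_upwards [hlim.eventually (gt_mem_nhds hη)] with n hn
  have hFint : Integrable (F n) :=
    hboundint.mono' (hFmeas n) (Eventually.of_forall (hFbound n))
  calc ∫ y, farDensity Ω φ Cw α u Γ n y ≤ ∫ y, (h y + F n y) :=
        integral_mono (hfint n) (hh_integrable.add hFint) fun y => by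
          have := le_max_left (farDensity Ω φ Cw α u Γ n y - h y) 0
          simp only [hF]
          linarith
    _ = (∫ x in Ω \ Γ, √(pd 0 u x ^ 2 + pd 1 u x ^ 2)) + ∫ y, F n y := by
        rw [integral_add hh_integrable hFint, hh, integral_indicator hU.measurableSet]
    _ ≤ _ := by linarith

lemma Rn_nonneg (hα : 0 < α) : 0 ≤ Rn Ω φ Cw α u n :=
  mul_nonneg (by positivity) (tsum_nonneg fun _ => chat_nonneg hα)

open Classical in
lemma Rn_le_near_add_far (hΩbdd : Bornology.IsBounded Ω) (hCw : 0 < Cw) :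
    Rn Ω φ Cw α u n ≤ (2 : ℝ) ^ (-(2 * (n : ℤ))) *
      ((((finite_Kn hΩbdd hCw n).toFinset.filter (IsNear Γ Cw n)).card : ℝ) * Mthr α n) +
        ∫ y, farDensity Ω φ Cw α u Γ n y := by
  set S := (finite_Kn hΩbdd hCw n).toFinset with hS
  have htsum : ∑' k : Kn Ω Cw n, chat Ω φ Cw α u n k = ∑ k ∈ S, chat Ω φ Cw α u n k := by
    rw [← Finset.tsum_subtype' S, hS, (finite_Kn hΩbdd hCw n).coe_toFinset]
  have hfar : ∫ y, farDensity Ω φ Cw α u Γ n y = (2 : ℝ) ^ (-(2 * (n : ℤ))) *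
      ∑ k ∈ S.filter (fun k => ¬ IsNear Γ Cw n k), chat Ω φ Cw α u n k := by
    rw [← integral_dyadic]
    refine integral_congr_ae (Eventually.of_forall fun y => ?_)
    simp only [farDensity, Finset.mem_filter, hS, Set.Finite.mem_toFinset]
  rw [Rn, htsum, ← Finset.sum_filter_add_sum_filter_not S (IsNear Γ Cw n), mul_add, hfar]
  gcongr
  rw [← nsmul_eq_mul]
  exact Finset.sum_le_card_nsmul _ _ _ fun k _ => min_le_left _ _

end Energy

lemma IsSimpleCurveUnion.isClosed {Γ : Set (EuclideanSpace ℝ (Fin 2))}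
    (hΓ : IsSimpleCurveUnion Γ) : IsClosed Γ := by
  obtain ⟨K, γ, b, -, hγ, -, -, -, rfl⟩ := hΓ
  exact isClosed_iUnion_of_finite fun i => (isCompact_Icc.image (hγ i).continuous).isClosed

end EnergyUpperBound

/-- energy upper bound for a piecewise-`C¹` function with
curve-supported singularity: `limsup R_n(u) ≤ ∫_{Ω\Γ̃} |∇u| + α ℋ¹(Γ̃)`. -/
theorem stmt11 (Ω : Set (EuclideanSpace ℝ (Fin 2))) (hΩopen : IsOpen Ω)
    (hΩne : Ω.Nonempty) (hΩbdd : Bornology.IsBounded Ω)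
    (φ : Fin 2 → EuclideanSpace ℝ (Fin 2) → ℝ) (Cw : ℝ) (hCw : 0 < Cw)
    (hφC1 : ∀ j, ContDiff ℝ 1 (φ j)) (hφnonneg : ∀ j y, 0 ≤ φ j y)
    (hφne : ∀ j, ∃ y, φ j y ≠ 0)
    (hφsupp : ∀ j, Function.support (φ j) ⊆
      Metric.closedBall (0 : EuclideanSpace ℝ (Fin 2)) Cw)
    (α : ℝ) (hα : 0 < α)
    (Γt : Set (EuclideanSpace ℝ (Fin 2))) (hΓt : IsSimpleCurveUnion Γt) (hΓtΩ : Γt ⊆ Ω)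
    (hdist : ∃ d : ℝ, 0 < d ∧ ∀ x ∈ Γt, ∀ y ∈ frontier Ω, d ≤ dist x y)
    (u : EuclideanSpace ℝ (Fin 2) → ℝ) (humeas : Measurable u)
    (hubdd : ∃ B : ℝ, ∀ x ∈ Ω, |u x| ≤ B)
    (huC1 : ContDiffOn ℝ 1 u (Ω \ Γt))
    (hgradbdd : ∃ B : ℝ, ∀ x ∈ Ω \ Γt, Real.sqrt (pd 0 u x ^ 2 + pd 1 u x ^ 2) ≤ B)
    (hgradext : ∃ G : EuclideanSpace ℝ (Fin 2) → ℝ × ℝ,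
      ContinuousOn G (closure Ω \ Γt) ∧
      ∀ x ∈ Ω \ Γt, G x = (pd 0 u x, pd 1 u x)) :
    Filter.limsup (fun n : ℕ => Rn Ω φ Cw α u n) Filter.atTop ≤
      (∫ x in Ω \ Γt, Real.sqrt (pd 0 u x ^ 2 + pd 1 u x ^ 2)) +
        α * (μH[1] Γt).toReal := by
  classical
  have hU : IsOpen (Ω \ Γt) := hΩopen.sdiff hΓt.isClosed
  refine le_of_forall_pos_le_add fun ε hε => ?_
  set L := (μH[1] Γt).toReal
  have hη : 0 < ε / (4 * α) := by positivity
  have hlim : Filter.Tendsto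
      (fun n => α * (1 + (2 * Cw + 4) * Hrad n) * (L + ε / (4 * α))) Filter.atTop
      (nhds (α * (1 + (2 * Cw + 4) * 0) * (L + ε / (4 * α)))) :=
    (((tendsto_Hrad.const_mul _).const_add 1).const_mul α).mul_const _
  have hlt : α * (1 + (2 * Cw + 4) * 0) * (L + ε / (4 * α)) < α * L + ε / 2 := by
    have : α * (1 + (2 * Cw + 4) * 0) * (L + ε / (4 * α)) = α * L + ε / 4 := by
      field_simp
      ring
    linarith
  refine Filter.limsup_le_of_le
    (Filter.isCoboundedUnder_le_of_le Filter.atTop (x := 0) fun n => Rn_nonneg hα) ?_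
  filter_upwards [hlim.eventually (gt_mem_nhds hlt), hΓt.eventually_near_sum_le hCw hα hη,
    eventually_integral_farDensity_le hΩopen hΩbdd hU hCw hα hφC1 hφnonneg hφne hφsupp huC1
      hgradbdd (half_pos hε)] with n hsmall hnear hfar
  have hsplit := Rn_le_near_add_far (Γ := Γt) (φ := φ) (α := α) (u := u) (n := n) hΩbdd hCw
  have hS := hnear _ fun k (hk : k ∈ (finite_Kn hΩbdd hCw n).toFinset.filter (IsNear Γt Cw n)) =>
    (Finset.mem_filter.1 hk).2
  linarith
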